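/- Assume that Berinde's Theorem 1.1 holds, i.e. assume: for every complete metric space (Y,ρ), every base point y₀ ∈ Y, every g : Y → Y, every increasing ψ : [0,∞) → [0,∞) continuous at 0 with ψ(0) = 0, and all constants Λ' ≥ 0, α ≥ 1, β ∈ [0,α], if ρ(g(x),g(y)) ≤ (1-ε)·ρ(x,y) + Λ'·ε^α·ψ(ε)·(1 + ρ(x,y₀) + ρ(y,y₀)) for every ε ∈ [0,1] and all x,y ∈ Y, then g has a unique fixed point y* and there is a constant C with 0 ≤ C ≤ Λ'·(1 + 4ρ(y*,y₀))·β such that ρ(y*, gⁿ(y₀)) ≤ C·(α/n)·∑_{k=1}^{n} ψ(α/k) for all n ≥ 1. Then, whenever a complete metric space (X,d), a base point x₀ ∈ X, a map f : X → X, such a function ψ, and constants Λ ≥ 0, α ≥ 1, β ∈ [0,α] satisfy d(f(x),f(y)) ≤ (1-ε)·d(x,y) + Λ·ε^α·ψ(ε)·(1 + d(x,x₀) + d(y,x₀)) for every ε ∈ [0,1] and all x,y ∈ X, the map f is constant. -/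

import Mathlib

/-- Changing the base point costs at most a multiplicative factor. -/
theorem one_add_dist_add_dist_le_mul {X : Type*} [PseudoMetricSpace X] (p q x y : X) :
    1 + dist x p + dist y p ≤ (1 + 2 * dist p q) * (1 + dist x q + dist y q) := by
  have hx := dist_triangle_right x p q
  have hy := dist_triangle_right y p q
  have hxy : 0 ≤ dist p q * (dist x q + dist y q) := by positivity
  linarith

/-- Fact B: if Berinde's Theorem 1.1 were true, then any map satisfying its
hypothesis would be constant. -/
theorem fact_B
    (H : ∀ (Y : Type) [MetricSpace Y] [CompleteSpace Y] (y₀ : Y) (g : Y → Y)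
        (ψ : ℝ → ℝ), (∀ t, 0 ≤ t → 0 ≤ ψ t) → MonotoneOn ψ (Set.Ici 0) →
        ContinuousWithinAt ψ (Set.Ici 0) 0 → ψ 0 = 0 →
        ∀ (Λ' α β : ℝ), 0 ≤ Λ' → 1 ≤ α → β ∈ Set.Icc 0 α →
        (∀ ε ∈ Set.Icc (0 : ℝ) 1, ∀ x y : Y,
          dist (g x) (g y) ≤ (1 - ε) * dist x y +
            Λ' * ε ^ α * ψ ε * (1 + dist x y₀ + dist y y₀)) →
        ∃ ys : Y, g ys = ys ∧ (∀ z : Y, g z = z → z = ys) ∧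
          ∃ C : ℝ, 0 ≤ C ∧ C ≤ Λ' * (1 + 4 * dist ys y₀) * β ∧
            ∀ n : ℕ, 1 ≤ n →
              dist ys (g^[n] y₀) ≤
                C * (α / n) * ∑ k ∈ Finset.Icc 1 n, ψ (α / k))
    {X : Type} [MetricSpace X] [CompleteSpace X] (x₀ : X) (f : X → X)
    (ψ : ℝ → ℝ)
    (hψ_nonneg : ∀ t, 0 ≤ t → 0 ≤ ψ t)
    (hψ_mono : MonotoneOn ψ (Set.Ici 0))
    (hψ_cont : ContinuousWithinAt ψ (Set.Ici 0) 0)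
    (hψ0 : ψ 0 = 0)
    (Λ α β : ℝ) (hΛ : 0 ≤ Λ) (hα : 1 ≤ α) (hβ : β ∈ Set.Icc 0 α)
    (hf : ∀ ε ∈ Set.Icc (0 : ℝ) 1, ∀ x y : X,
      dist (f x) (f y) ≤ (1 - ε) * dist x y +
        Λ * ε ^ α * ψ ε * (1 + dist x x₀ + dist y x₀)) :
    ∀ x y : X, f x = f y := by
  have key : ∀ z : X, f (f z) = f z ∧ ∀ w : X, f w = w → w = f z := by
    intro z
    have hbase : ∀ ε ∈ Set.Icc (0 : ℝ) 1, ∀ x y : X,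
        dist (f x) (f y) ≤ (1 - ε) * dist x y +
          (Λ * (1 + 2 * dist x₀ z)) * ε ^ α * ψ ε * (1 + dist x z + dist y z) := by
      intro ε hε x y
      have hcoef : 0 ≤ Λ * ε ^ α * ψ ε :=
        mul_nonneg (mul_nonneg hΛ (Real.rpow_nonneg hε.1 α)) (hψ_nonneg ε hε.1)
      have hdist := mul_le_mul_of_nonneg_left
        (one_add_dist_add_dist_le_mul x₀ z x y) hcoef
      linarith [hf ε hε x y]
    obtain ⟨ys, hfix, huniq, C, hC0, hC, hrate⟩ :=
      H X z f ψ hψ_nonneg hψ_mono hψ_cont hψ0 (Λ * (1 + 2 * dist x₀ z)) α 0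
        (by positivity) hα ⟨le_rfl, by linarith⟩ hbase
    have hCzero : C = 0 := le_antisymm (by simpa using hC) hC0
    have hys : ys = f z := by
      have h := hrate 1 le_rfl
      rw [hCzero, zero_mul, zero_mul, Function.iterate_one] at h
      exact dist_le_zero.mp h
    subst hys
    exact ⟨hfix, huniq⟩
  intro x y
  exact (key y).2 (f x) (key x).1
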